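/- arXiv:1708.00085 — 7 statements merged into one kernel-verified Lean document; each statement's English description precedes it below -/
import Mathlib

section
/- Theorem 1 (stationarity of the Dynamic Spike-and-Slab process, kernel-invariance form). Let 0<Θ<1, λ₀>0, λ₁>0, φ₀∈ℝ and |φ₁|<1. Then for every β'∈ℝ, ∫_ℝ K(β'|β)·π^ST(β) dβ = π^ST(β'); that is, the spike-and-slab density π^ST(β) = Θ·ψ₁ST(β) + (1−Θ)·ψ₀(β|λ₀) is invariant under the DSS transition density K. -/
open MeasureTheory Real

/-- Laplace density with rate `lam`. -/
noncomputable def laplacePdf (lam β : ℝ) : ℝ := (lam / 2) * Real.exp (-(lam * |β|))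

/-- Gaussian density with mean `m` and variance `v`. -/
noncomputable def gaussPdf (m v β : ℝ) : ℝ :=
  (1 / Real.sqrt (2 * Real.pi * v)) * Real.exp (-((β - m) ^ 2) / (2 * v))

/-- Stationary slab density: Gaussian with mean `φ0` and variance `λ1/(1-φ1²)`. -/
noncomputable def psi1ST (l1 φ0 φ1 β : ℝ) : ℝ := gaussPdf φ0 (l1 / (1 - φ1 ^ 2)) β

/-- Evolving mixing weight `θ(β)`. -/
noncomputable def mixW (Θ l0 l1 φ0 φ1 β : ℝ) : ℝ :=
  Θ * psi1ST l1 φ0 φ1 β / (Θ * psi1ST l1 φ0 φ1 β + (1 - Θ) * laplacePdf l0 β)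

/-- DSS transition density `K(β'|β)`. -/
noncomputable def dssK (Θ l0 l1 φ0 φ1 β' β : ℝ) : ℝ :=
  (1 - mixW Θ l0 l1 φ0 φ1 β) * laplacePdf l0 β' +
    mixW Θ l0 l1 φ0 φ1 β * gaussPdf (φ0 + φ1 * (β - φ0)) l1 β'

/-- DSS stationary (spike-and-slab) marginal density `π^ST(β)`. -/
noncomputable def dssPiST (Θ l0 l1 φ0 φ1 β : ℝ) : ℝ :=
  Θ * psi1ST l1 φ0 φ1 β + (1 - Θ) * laplacePdf l0 β

theorem gaussPdf_eq_gaussianPDFReal (m : ℝ) {v : ℝ} (hv : 0 < v) :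
    gaussPdf m v = ProbabilityTheory.gaussianPDFReal m ⟨v, hv.le⟩ := by
  ext x
  simp only [gaussPdf, ProbabilityTheory.gaussianPDFReal, one_div]
  rfl

theorem integrable_gaussPdf (m : ℝ) {v : ℝ} (hv : 0 < v) : Integrable (gaussPdf m v) := by
  rw [gaussPdf_eq_gaussianPDFReal m hv]
  exact ProbabilityTheory.integrable_gaussianPDFReal _ _

theorem integral_gaussPdf (m : ℝ) {v : ℝ} (hv : 0 < v) : ∫ x, gaussPdf m v x = 1 := by
  rw [gaussPdf_eq_gaussianPDFReal m hv]
  exact ProbabilityTheory.integral_gaussianPDFReal_eq_one m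
    (fun h => hv.ne' (congrArg NNReal.toReal h))

theorem gaussPdf_pos (m : ℝ) {v : ℝ} (hv : 0 < v) (x : ℝ) : 0 < gaussPdf m v x := by
  unfold gaussPdf
  positivity

theorem integral_laplacePdf {lam : ℝ} (h : 0 < lam) : ∫ x, laplacePdf lam x = 1 := by
  have hexp : ∫ x in Set.Ioi (0 : ℝ), Real.exp (-(lam * x)) = 1 / lam := by
    have := integral_exp_mul_Ioi (neg_lt_zero.mpr h) 0
    simpa [neg_mul] using this
  unfold laplacePdf
  rw [integral_const_mul, integral_comp_abs (f := fun x => Real.exp (-(lam * x))), hexp]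
  field_simp

theorem integrable_laplacePdf {lam : ℝ} (h : 0 < lam) : Integrable (laplacePdf lam) :=
  Integrable.of_integral_ne_zero (by rw [integral_laplacePdf h]; exact one_ne_zero)

theorem laplacePdf_pos {lam : ℝ} (h : 0 < lam) (x : ℝ) : 0 < laplacePdf lam x := by
  unfold laplacePdf
  positivity

/-- Detailed balance of the Gaussian autoregression with respect to its stationary law. -/
theorem psi1ST_mul_gaussPdf_comm {l1 φ1 : ℝ} (hl1 : 0 < l1) (hφ1 : |φ1| < 1) (φ0 x y : ℝ) :
    psi1ST l1 φ0 φ1 x * gaussPdf (φ0 + φ1 * (x - φ0)) l1 y =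
      psi1ST l1 φ0 φ1 y * gaussPdf (φ0 + φ1 * (y - φ0)) l1 x := by
  have h : 1 - φ1 ^ 2 ≠ 0 := by
    have := (sq_lt_one_iff_abs_lt_one φ1).mpr hφ1
    linarith
  simp only [psi1ST, gaussPdf]
  rw [mul_mul_mul_comm, mul_mul_mul_comm (1 / √_) (rexp (-(y - φ0) ^ 2 / _)), ← Real.exp_add, ← Real.exp_add]
  congr 2
  field_simp
  ring

/-- The mixing weight cancels the marginal density in its denominator. -/
theorem dssK_mul_dssPiST {Θ l0 l1 φ0 φ1 : ℝ} {x : ℝ} (y : ℝ)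
    (h : dssPiST Θ l0 l1 φ0 φ1 x ≠ 0) :
    dssK Θ l0 l1 φ0 φ1 y x * dssPiST Θ l0 l1 φ0 φ1 x =
      (1 - Θ) * laplacePdf l0 y * laplacePdf l0 x +
        Θ * (psi1ST l1 φ0 φ1 x * gaussPdf (φ0 + φ1 * (x - φ0)) l1 y) := by
  unfold dssK mixW
  unfold dssPiST at h ⊢
  field_simp
  ring

/-- Theorem 1 (kernel-invariance form): the spike-and-slab density `π^ST` is
invariant under the DSS transition density `K`. -/
theorem dss_stationary_kernel_invariance
    (Θ l0 l1 φ0 φ1 : ℝ)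
    (hΘ0 : 0 < Θ) (hΘ1 : Θ < 1) (hl0 : 0 < l0) (hl1 : 0 < l1) (hφ1 : |φ1| < 1) :
    ∀ β' : ℝ,
      (∫ β : ℝ, dssK Θ l0 l1 φ0 φ1 β' β * dssPiST Θ l0 l1 φ0 φ1 β) =
        dssPiST Θ l0 l1 φ0 φ1 β' := by
  intro y
  have hv : 0 < l1 / (1 - φ1 ^ 2) :=
    div_pos hl1 (sub_pos.mpr ((sq_lt_one_iff_abs_lt_one φ1).mpr hφ1))
  have hpos (x : ℝ) : dssPiST Θ l0 l1 φ0 φ1 x ≠ 0 :=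
    (add_pos (mul_pos hΘ0 (gaussPdf_pos φ0 hv x))
      (mul_pos (sub_pos.mpr hΘ1) (laplacePdf_pos hl0 x))).ne'
  have hint (x : ℝ) : dssK Θ l0 l1 φ0 φ1 y x * dssPiST Θ l0 l1 φ0 φ1 x =
      (1 - Θ) * laplacePdf l0 y * laplacePdf l0 x +
        Θ * psi1ST l1 φ0 φ1 y * gaussPdf (φ0 + φ1 * (y - φ0)) l1 x := by
    rw [dssK_mul_dssPiST y (hpos x), psi1ST_mul_gaussPdf_comm hl1 hφ1, ← mul_assoc Θ]
  simp_rw [hint]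
  rw [integral_add ((integrable_laplacePdf hl0).const_mul _)
      ((integrable_gaussPdf _ hl1).const_mul _), integral_const_mul, integral_const_mul,
    integral_laplacePdf hl0, integral_gaussPdf _ hl1, dssPiST]
  ring
end

section
/- General two-component mixture stationarity recipe. Let 0<Θ<1, let ψ₀ and s be everywhere-positive measurable probability densities on ℝ (each integrating to 1), and let k(·|β) be a measurable family of probability densities on ℝ such that for every β'∈ℝ the function β ↦ k(β'|β)·s(β) is integrable and ∫_ℝ k(β'|β)·s(β) dβ = s(β') (i.e., s is invariant for the slab kernel k). Define θ(β) = Θ·s(β)/(Θ·s(β)+(1−Θ)·ψ₀(β)) and K(β'|β) = (1−θ(β))·ψ₀(β') + θ(β)·k(β'|β). Then for every β'∈ℝ, ∫_ℝ K(β'|β)·[Θ·s(β)+(1−Θ)·ψ₀(β)] dβ = Θ·s(β') + (1−Θ)·ψ₀(β'). -/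
open MeasureTheory Real

/-- General two-component mixture stationarity recipe.
If `s` is invariant for the slab kernel `k`, then the mixture density
`Θ·s + (1−Θ)·ψ0` is invariant for the switching kernel
`K(β'|β) = (1−θ(β))·ψ0(β') + θ(β)·k(β'|β)` with
`θ(β) = Θ·s(β)/(Θ·s(β)+(1−Θ)·ψ0(β))`. -/
theorem mixture_stationarity_recipe
    (Θ : ℝ) (hΘ0 : 0 < Θ) (hΘ1 : Θ < 1)
    (ψ0 s : ℝ → ℝ) (k : ℝ → ℝ → ℝ)  -- `k β' β` is the slab transition density `k(β'|β)`
    (hψ0meas : Measurable ψ0) (hsmeas : Measurable s)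
    (hkmeas : Measurable (Function.uncurry k))
    (hψ0pos : ∀ β, 0 < ψ0 β) (hspos : ∀ β, 0 < s β)
    (hψ0int : (∫ β : ℝ, ψ0 β) = 1) (hsint : (∫ β : ℝ, s β) = 1)
    (hknonneg : ∀ β' β, 0 ≤ k β' β)
    (hkprob : ∀ β : ℝ, (∫ β' : ℝ, k β' β) = 1)
    (hintegrable : ∀ β' : ℝ, Integrable (fun β : ℝ => k β' β * s β))
    (hinv : ∀ β' : ℝ, (∫ β : ℝ, k β' β * s β) = s β') :
    ∀ β' : ℝ,
      (∫ β : ℝ,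
          ((1 - Θ * s β / (Θ * s β + (1 - Θ) * ψ0 β)) * ψ0 β' +
            (Θ * s β / (Θ * s β + (1 - Θ) * ψ0 β)) * k β' β) *
          (Θ * s β + (1 - Θ) * ψ0 β)) =
        Θ * s β' + (1 - Θ) * ψ0 β' := by
  intro β'
  have hψ0 : Integrable ψ0 := by
    by_contra h
    rw [integral_undef h] at hψ0int
    exact zero_ne_one hψ0int
  have key : ∀ β : ℝ,
      ((1 - Θ * s β / (Θ * s β + (1 - Θ) * ψ0 β)) * ψ0 β' +
          (Θ * s β / (Θ * s β + (1 - Θ) * ψ0 β)) * k β' β) *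
        (Θ * s β + (1 - Θ) * ψ0 β) =
      (1 - Θ) * ψ0 β' * ψ0 β + Θ * (k β' β * s β) := by
    intro β
    have hpos : 0 < Θ * s β + (1 - Θ) * ψ0 β :=
      add_pos (mul_pos hΘ0 (hspos β)) (mul_pos (sub_pos.2 hΘ1) (hψ0pos β))
    have hdiv := div_mul_cancel₀ (Θ * s β) hpos.ne'
    linear_combination (k β' β - ψ0 β') * hdiv
  simp_rw [key]
  rw [integral_add (hψ0.const_mul _) ((hintegrable β').const_mul _), integral_const_mul,
    integral_const_mul, hψ0int, hinv β']
  ring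
end

section
/- Monotonicity of the mixing weight and dominance of the Laplace tails. Let 0<Θ<1, λ₀>0, λ₁>0, φ₀=0 and |φ₁|<1, let θ(β) = Θ·ψ₁ST(β)/(Θ·ψ₁ST(β)+(1−Θ)·ψ₀(β|λ₀)), and set δ₀ = λ₀·λ₁/(1−φ₁²). Then θ is an even function of β, θ is strictly increasing on the interval (0, δ₀), and θ is strictly decreasing on the interval (δ₀, ∞) (so the mixing weight eventually decreases as |β| grows, reflecting the dominance of the Laplace spike's tails over the Gaussian slab's tails). -/
open MeasureTheory Real Set

/-- Mixing weight with `φ0 = 0`: stationary slab is Gaussian with mean `0`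
and variance `λ1/(1−φ1²)`. -/
noncomputable def mixW0 (Θ l0 l1 φ1 β : ℝ) : ℝ :=
  Θ * gaussPdf 0 (l1 / (1 - φ1 ^ 2)) β /
    (Θ * gaussPdf 0 (l1 / (1 - φ1 ^ 2)) β + (1 - Θ) * laplacePdf l0 β)

/-- The mixing weight is a strictly increasing function of the log-likelihood ratio
`l0 |β| - β² / (2 v)` of slab to spike, up to an additive constant. -/
lemma mixW0_lt_mixW0 {Θ l0 l1 φ1 x y : ℝ} (hΘ0 : 0 < Θ) (hΘ1 : Θ < 1) (hl0 : 0 < l0)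
    (hv : 0 < l1 / (1 - φ1 ^ 2))
    (h : l0 * |x| - x ^ 2 / (2 * (l1 / (1 - φ1 ^ 2))) <
      l0 * |y| - y ^ 2 / (2 * (l1 / (1 - φ1 ^ 2)))) :
    mixW0 Θ l0 l1 φ1 x < mixW0 Θ l0 l1 φ1 y := by
  unfold mixW0 gaussPdf laplacePdf
  generalize l1 / (1 - φ1 ^ 2) = v at hv h ⊢
  have hΘ : 0 < 1 - Θ := sub_pos.2 hΘ1
  have hexp : exp (-((x - 0) ^ 2) / (2 * v)) * exp (-(l0 * |y|)) <
      exp (-((y - 0) ^ 2) / (2 * v)) * exp (-(l0 * |x|)) := by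
    rw [← exp_add, ← exp_add, exp_lt_exp, sub_zero, sub_zero, neg_div, neg_div]
    linarith
  have hc : 0 < Θ * (1 / √(2 * π * v)) * ((1 - Θ) * (l0 / 2)) := by positivity
  rw [div_lt_div_iff₀ (by positivity) (by positivity)]
  linarith [mul_lt_mul_of_pos_left hexp hc]

/-- Increments of the log-likelihood ratio factor through `2 l0 v - (x + y)`. -/
lemma sub_sq_div_sub_sub_sq_div {l0 v x y : ℝ} (hv : v ≠ 0) :
    (l0 * y - y ^ 2 / (2 * v)) - (l0 * x - x ^ 2 / (2 * v)) =
      (y - x) * (2 * (l0 * v) - (x + y)) / (2 * v) := by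
  field_simp
  ring

/-- Monotonicity of the mixing weight and dominance of the Laplace tails:
`θ` is even, strictly increasing on `(0, δ₀)` and strictly decreasing on
`(δ₀, ∞)`, where `δ₀ = λ₀λ₁/(1−φ₁²)`. -/
theorem mixing_weight_monotonicity
    (Θ l0 l1 φ1 : ℝ)
    (hΘ0 : 0 < Θ) (hΘ1 : Θ < 1) (hl0 : 0 < l0) (hl1 : 0 < l1) (hφ1 : |φ1| < 1) :
    (∀ β : ℝ, mixW0 Θ l0 l1 φ1 (-β) = mixW0 Θ l0 l1 φ1 β) ∧
    StrictMonoOn (mixW0 Θ l0 l1 φ1) (Ioo 0 (l0 * l1 / (1 - φ1 ^ 2))) ∧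
    StrictAntiOn (mixW0 Θ l0 l1 φ1) (Ioi (l0 * l1 / (1 - φ1 ^ 2))) := by
  have hv : 0 < l1 / (1 - φ1 ^ 2) := div_pos hl1 (sub_pos.2 ((sq_lt_one_iff_abs_lt_one φ1).2 hφ1))
  have hδ : 0 < l0 * (l1 / (1 - φ1 ^ 2)) := mul_pos hl0 hv
  refine ⟨fun β => by simp [mixW0, gaussPdf, laplacePdf], ?_, ?_⟩
  · rintro x ⟨hx0, hx⟩ y ⟨hy0, hy⟩ hxy
    rw [mul_div_assoc] at hx hy
    refine mixW0_lt_mixW0 hΘ0 hΘ1 hl0 hv ?_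
    rw [abs_of_pos hx0, abs_of_pos hy0, ← sub_pos, sub_sq_div_sub_sub_sq_div hv.ne']
    exact div_pos (mul_pos (by linarith) (by linarith)) (by linarith)
  · intro x hx y hy hxy
    rw [mem_Ioi, mul_div_assoc] at hx hy
    refine mixW0_lt_mixW0 hΘ0 hΘ1 hl0 hv ?_
    rw [abs_of_pos (hδ.trans hx), abs_of_pos (hδ.trans hy), ← sub_pos,
      sub_sq_div_sub_sub_sq_div hv.ne']
    exact div_pos (mul_pos_of_neg_of_neg (by linarith) (by linarith)) (by linarith)
end

section
/- Lemma 1, selection part (thresholding characterization of a zero mode). Let g: ℝ→ℝ satisfy g(0)=0 and let y∈ℝ. Define the selection thresholds (as extended reals) Δ⁺ = inf_{β>0} ( β/2 − g(β)/β ) and Δ⁻ = sup_{β<0} ( β/2 − g(β)/β ). Then 0 is a global maximizer of the map f(β) = −(1/2)(y−β)² + g(β) over ℝ if and only if Δ⁻ ≤ y ≤ Δ⁺. -/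
open Real

/-- Away from `0`, the gain of moving from `0` to `β` is `β` times the gap between `y` and the
threshold quotient at `β`. -/
lemma objective_le_iff_mul_sub_nonpos {y β c : ℝ} (hβ : β ≠ 0) :
    -(1 / 2) * (y - β) ^ 2 + c ≤ -(1 / 2) * (y - 0) ^ 2 + 0 ↔
      β * (y - (β / 2 - c / β)) ≤ 0 := by
  have h : β * (y - (β / 2 - c / β)) =
      (-(1 / 2) * (y - β) ^ 2 + c) - (-(1 / 2) * (y - 0) ^ 2 + 0) := by
    field_simp
    ring
  rw [h, sub_nonpos]

/-- Lemma 1, selection part: `0` is a global maximizer of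
`f(β) = −(1/2)(y−β)² + g(β)` if and only if `Δ⁻ ≤ y ≤ Δ⁺`, where the
thresholds are `Δ⁺ = inf_{β>0}(β/2 − g(β)/β)` and `Δ⁻ = sup_{β<0}(β/2 − g(β)/β)`
computed in the extended reals. -/
theorem selection_thresholding_zero_mode
    (g : ℝ → ℝ) (hg0 : g 0 = 0) (y : ℝ) :
    (∀ β : ℝ, -(1 / 2) * (y - β) ^ 2 + g β ≤ -(1 / 2) * (y - 0) ^ 2 + g 0) ↔
      ((⨆ (β : ℝ) (_ : β < 0), ((β / 2 - g β / β : ℝ) : EReal)) ≤ (y : EReal) ∧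
        (y : EReal) ≤ ⨅ (β : ℝ) (_ : 0 < β), ((β / 2 - g β / β : ℝ) : EReal)) := by
  simp only [iSup_le_iff, le_iInf_iff, EReal.coe_le_coe_iff, hg0]
  constructor
  · intro h
    refine ⟨fun β hβ => ?_, fun β hβ => ?_⟩
    · have := (objective_le_iff_mul_sub_nonpos hβ.ne).1 (h β)
      exact sub_nonneg.1 (nonneg_of_mul_nonpos_right this hβ)
    · have := (objective_le_iff_mul_sub_nonpos hβ.ne').1 (h β)
      exact sub_nonpos.1 (nonpos_of_mul_nonpos_right this hβ)
  · rintro ⟨hneg, hpos⟩ β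
    rcases lt_trichotomy β 0 with hβ | rfl | hβ
    · exact (objective_le_iff_mul_sub_nonpos hβ.ne).2
        (mul_nonpos_of_nonpos_of_nonneg hβ.le (sub_nonneg.2 (hneg β hβ)))
    · rw [hg0]
    · exact (objective_le_iff_mul_sub_nonpos hβ.ne').2
        (mul_nonpos_of_nonneg_of_nonpos hβ.le (sub_nonpos.2 (hpos β hβ)))
end

section
/- Lemma 2 (coordinate-wise characterization of the mode in general regression). Let g: ℝ→ℝ with g(0)=0, let x≠0 and z∈ℝ, and consider f(β) = −(1/2)(z−xβ)² + g(β). Define Δ⁺ = inf_{β>0} ( x²β/2 − g(β)/β ) and Δ⁻ = sup_{β<0} ( x²β/2 − g(β)/β ) (as extended reals), and set Z = x·z. Then: (i) 0 is a global maximizer of f if and only if Δ⁻ ≤ Z ≤ Δ⁺; and (ii) if β̂≠0 is a local maximizer of f, g is differentiable at β̂, and g'(β̂) = −Λ·sign(β̂) with Λ ≥ 0, then |Z| > Λ and β̂ = (1/x²)·(|Z| − Λ)·sign(Z). -/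
open Real

/-- Lemma 2 (coordinate-wise characterization of the mode in general
regression) for `f(β) = −(1/2)(z−xβ)² + g(β)` with `x ≠ 0` and `Z = x·z`:
(i) `0` is a global maximizer of `f` iff `Δ⁻ ≤ Z ≤ Δ⁺` where
`Δ⁺ = inf_{β>0}(x²β/2 − g(β)/β)` and `Δ⁻ = sup_{β<0}(x²β/2 − g(β)/β)`
(in the extended reals); and (ii) if `β̂ ≠ 0` is a local maximizer of `f`,
`g` is differentiable at `β̂` with `g'(β̂) = −Λ·sign(β̂)`, `Λ ≥ 0`, then
`|Z| > Λ` and `β̂ = (1/x²)(|Z| − Λ)·sign(Z)`. -/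
theorem coordinatewise_mode_characterization
    (g : ℝ → ℝ) (hg0 : g 0 = 0) (x z : ℝ) (hx : x ≠ 0) :
    ((∀ β : ℝ, -(1 / 2) * (z - x * β) ^ 2 + g β ≤ -(1 / 2) * (z - x * 0) ^ 2 + g 0) ↔
        ((⨆ (β : ℝ) (_ : β < 0), ((x ^ 2 * β / 2 - g β / β : ℝ) : EReal)) ≤ ((x * z : ℝ) : EReal) ∧
          ((x * z : ℝ) : EReal) ≤ ⨅ (β : ℝ) (_ : 0 < β), ((x ^ 2 * β / 2 - g β / β : ℝ) : EReal))) ∧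
      (∀ (βhat Λ : ℝ), βhat ≠ 0 →
        IsLocalMax (fun β : ℝ => -(1 / 2) * (z - x * β) ^ 2 + g β) βhat →
        0 ≤ Λ →
        HasDerivAt g (-Λ * Real.sign βhat) βhat →
        Λ < |x * z| ∧ βhat = (1 / x ^ 2) * (|x * z| - Λ) * Real.sign (x * z)) := by
  simp only [iSup_le_iff, le_iInf_iff, EReal.coe_le_coe_iff]
  have slope (β : ℝ) (hβ : β ≠ 0) :
      (x ^ 2 * β / 2 - g β / β - x * z) * β = x ^ 2 * β ^ 2 / 2 - g β - x * z * β := by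
    field_simp
  refine ⟨⟨fun h => ⟨fun β hβ => ?_, fun β hβ => ?_⟩, fun ⟨hneg, hpos⟩ β => ?_⟩, ?_⟩
  · have hs := slope β hβ.ne
    have hm := h β
    rw [hg0] at hm
    by_contra! hlt
    nlinarith [mul_neg_of_pos_of_neg (sub_pos.2 hlt) hβ]
  · have hs := slope β hβ.ne'
    have hm := h β
    rw [hg0] at hm
    by_contra! hlt
    nlinarith [mul_neg_of_neg_of_pos (sub_neg.2 hlt) hβ]
  · rw [hg0]
    rcases lt_trichotomy β 0 with hβ | rfl | hβ
    · nlinarith [slope β hβ.ne, mul_nonneg_of_nonpos_of_nonpos (sub_nonpos.2 (hneg β hβ)) hβ.le]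
    · rw [hg0]
    · nlinarith [slope β hβ.ne', mul_nonneg (sub_nonneg.2 (hpos β hβ)) hβ.le]
  · intro b Λ hb hmax hΛ hg
    have hlin : HasDerivAt (fun β : ℝ => z - x * β) (-x) b := by
      simpa using ((hasDerivAt_id b).const_mul x).const_sub z
    have hcrit := hmax.hasDerivAt_eq_zero (((hlin.pow 2).const_mul (-(1 / 2))).add hg)
    have hZ : x * z = x ^ 2 * b + Λ * Real.sign b := by
      norm_num at hcrit
      linarith
    have hx2 : 0 < x ^ 2 := by positivity
    rcases lt_or_gt_of_ne hb with hb | hb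
    · rw [Real.sign_of_neg hb] at hZ
      have hxb := mul_neg_of_pos_of_neg hx2 hb
      have hneg : x * z < 0 := by linarith
      rw [abs_of_neg hneg, Real.sign_of_neg hneg, hZ]
      refine ⟨by linarith, ?_⟩
      field_simp
      ring
    · rw [Real.sign_of_pos hb] at hZ
      have hxb := mul_pos hx2 hb
      have hpos : 0 < x * z := by linarith
      rw [abs_of_pos hpos, Real.sign_of_pos hpos, hZ]
      refine ⟨by linarith, ?_⟩
      field_simp
      ring
end

section
/- Laplace distribution as a Gaussian scale mixture with exponential mixing. For every λ>0 and every β∈ℝ, ∫₀^∞ (2πψ)^{−1/2}·exp(−β²/(2ψ)) · (λ²/2)·exp(−(λ²/2)·ψ) dψ = (λ/2)·exp(−λ|β|); that is, a Gaussian with mean 0 and random variance ψ distributed as Exponential with rate λ²/2 has a Laplace(λ) marginal density. -/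
open MeasureTheory Real Set

/-- The Cauchy–Schlömilch transformation of the half-line Gaussian integral. -/
lemma integral_Ioi_exp_neg_sq_mul_sub_div {a b : ℝ} (ha : 0 < a) (hb : 0 ≤ b) :
    ∫ x in Ioi (0 : ℝ), exp (-(1 / 2) * (a * x - b / x) ^ 2) = √(2 * π) / (2 * a) := by
  have hgauss : ∫ u : ℝ, exp (-(1 / 2) * u ^ 2) = √(2 * π) := by
    rw [integral_gaussian]; congr 1; ring
  rcases hb.eq_or_lt with rfl | hb
  · have h : ∀ x : ℝ, exp (-(1 / 2) * (a * x - 0 / x) ^ 2) = exp (-(a ^ 2 / 2) * x ^ 2) := by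
      intro x; congr 1; ring
    simp_rw [h]
    rw [integral_gaussian_Ioi, show π / (a ^ 2 / 2) = 2 * π / a ^ 2 by field_simp,
      sqrt_div (by positivity), sqrt_sq ha.le]
    field_simp
  · set s : ℝ → ℝ := fun u => √(u ^ 2 + 4 * a * b) with hs
    have hab : 0 < a * b := mul_pos ha hb
    have hpos : ∀ u : ℝ, 0 < u ^ 2 + 4 * a * b := fun u => by nlinarith [sq_nonneg u]
    have hs_pos : ∀ u, 0 < s u := fun u => sqrt_pos.2 (hpos u)
    have hs_sq : ∀ u, s u ^ 2 = u ^ 2 + 4 * a * b := fun u => sq_sqrt (hpos u).le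
    have habs : ∀ u, |u| < s u := fun u =>
      abs_lt_of_sq_lt_sq (by rw [hs_sq u]; nlinarith [hab]) (hs_pos u).le
    set f : ℝ → ℝ := fun u => (u + s u) / (2 * a) with hf
    have hf_pos : ∀ u, 0 < f u := fun u =>
      div_pos (by linarith [(abs_lt.1 (habs u)).1]) (by positivity)
    have hf_inv : ∀ u, a * f u - b / f u = u := by
      intro u
      have h1 := hf_pos u
      have h2 : a * (f u) ^ 2 - b = u * f u := by
        simp only [hf]
        field_simp
        nlinarith [hs_sq u]
      field_simp
      linarith
    have hderiv : ∀ u, HasDerivAt f ((1 + u / s u) / (2 * a)) u := by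
      intro u
      have h1 : HasDerivAt (fun v : ℝ => v ^ 2 + 4 * a * b) (2 * u) u := by
        simpa using (hasDerivAt_pow 2 u).add_const (4 * a * b)
      have h2 := ((hasDerivAt_id u).add (h1.sqrt (hpos u).ne')).div_const (2 * a)
      rwa [mul_div_mul_left _ _ two_ne_zero] at h2
    have himage : f '' univ = Ioi 0 := by
      ext x
      simp only [image_univ, mem_range, mem_Ioi]
      refine ⟨fun ⟨u, hu⟩ => hu ▸ hf_pos u, fun hx => ⟨a * x - b / x, ?_⟩⟩
      have h : s (a * x - b / x) = a * x + b / x := by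
        rw [hs]
        refine (sqrt_eq_iff_mul_self_eq_of_pos (by positivity)).2 ?_
        field_simp
        ring
      simp only [hf, h]
      field_simp
      ring
    have hinj : InjOn f univ := fun u _ v _ h => by rw [← hf_inv u, ← hf_inv v, h]
    have hbound : ∀ u, |u / s u| ≤ 1 := fun u => by
      rw [abs_div, abs_of_pos (hs_pos u)]
      exact (div_le_one (hs_pos u)).2 (habs u).le
    have hint : Integrable fun u : ℝ => exp (-(1 / 2) * u ^ 2) :=
      integrable_exp_neg_mul_sq (by norm_num)
    have hmeas : Measurable fun u : ℝ => u / s u := by fun_prop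
    have hodd_int : Integrable fun u : ℝ => u / s u * exp (-(1 / 2) * u ^ 2) :=
      hint.bdd_mul (c := 1) hmeas.aestronglyMeasurable (.of_forall hbound)
    have hodd : ∫ u : ℝ, u / s u * exp (-(1 / 2) * u ^ 2) = 0 := by
      have h := integral_neg_eq_self (fun u : ℝ => u / s u * exp (-(1 / 2) * u ^ 2)) volume
      simp only [hs, neg_sq, neg_div, neg_mul, integral_neg] at h ⊢
      linarith
    rw [← himage, integral_image_eq_integral_abs_deriv_smul MeasurableSet.univ
      (fun u _ => (hderiv u).hasDerivWithinAt) hinj, setIntegral_univ]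
    have h : ∀ u, |(1 + u / s u) / (2 * a)| • exp (-(1 / 2) * (a * f u - b / f u) ^ 2) =
        (exp (-(1 / 2) * u ^ 2) + u / s u * exp (-(1 / 2) * u ^ 2)) / (2 * a) := by
      intro u
      rw [hf_inv, abs_of_nonneg
        (div_nonneg (by linarith [(abs_le.1 (hbound u)).1]) (by positivity)), smul_eq_mul]
      ring
    simp_rw [h]
    rw [integral_div, integral_add hint hodd_int, hodd, hgauss, add_zero]

/-- Laplace distribution as a Gaussian scale mixture with exponential mixing:
a Gaussian with mean `0` and random variance `ψ ~ Exponential(λ²/2)` has a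
Laplace(λ) marginal density. -/
theorem laplace_gaussian_scale_mixture
    (lam : ℝ) (hlam : 0 < lam) :
    ∀ β : ℝ,
      (∫ ψ in Ioi (0 : ℝ),
          (1 / Real.sqrt (2 * Real.pi * ψ)) * Real.exp (-(β ^ 2) / (2 * ψ)) *
            ((lam ^ 2 / 2) * Real.exp (-(lam ^ 2 / 2) * ψ))) =
        (lam / 2) * Real.exp (-(lam * |β|)) := by
  intro β
  rw [← integral_comp_rpow_Ioi_of_pos (p := 2) two_pos]
  have h : ∀ x ∈ Ioi (0 : ℝ),
      ((2 : ℝ) * x ^ ((2 : ℝ) - 1)) • ((1 / √(2 * π * x ^ (2 : ℝ))) *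
        exp (-(β ^ 2) / (2 * x ^ (2 : ℝ))) *
          ((lam ^ 2 / 2) * exp (-(lam ^ 2 / 2) * x ^ (2 : ℝ)))) =
      (lam ^ 2 / √(2 * π) * exp (-(lam * |β|))) *
        exp (-(1 / 2) * (lam * x - |β| / x) ^ 2) := by
    intro x hx
    have hx : 0 < x := hx
    have hexp : exp (-(β ^ 2) / (2 * x ^ 2)) * exp (-(lam ^ 2 / 2) * x ^ 2) =
        exp (-(lam * |β|)) * exp (-(1 / 2) * (lam * x - |β| / x) ^ 2) := by
      rw [← exp_add, ← exp_add, ← sq_abs β]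
      congr 1
      field_simp
      ring
    rw [show (2 : ℝ) - 1 = 1 by norm_num, rpow_one, rpow_two, smul_eq_mul,
      sqrt_mul (by positivity), sqrt_sq hx.le, mul_assoc (lam ^ 2 / √(2 * π)), ← hexp]
    field_simp
  rw [setIntegral_congr_fun measurableSet_Ioi h, integral_const_mul,
    integral_Ioi_exp_neg_sq_mul_sub_div hlam (abs_nonneg β)]
  field_simp
end

section
/- Invariance of the exponential distribution under the Poisson–Gamma transition of the LAR process. Let λ>0 and 0<ρ<1, and set r = λ²/(2(1−ρ)) and θ = λ²/2. Then for every ψ'>0, ∑_{k=0}^∞ ∫₀^∞ [ r^{k+1}·ψ'^{k}·e^{−r·ψ'} / k! ] · [ e^{−ρ r ψ}·(ρ r ψ)^{k} / k! ] · θ·e^{−θψ} dψ = θ·e^{−θψ'}; that is, if ψ ~ Exponential(λ²/2), κ|ψ ~ Poisson(ρ·λ²·ψ/(2(1−ρ))) and ψ'|κ ~ Gamma(1+κ, rate λ²/(2(1−ρ))), then marginally ψ' ~ Exponential(λ²/2). -/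
open MeasureTheory Real Set

/-- The unnormalised Gamma density of shape `1 + k` and rate `r` integrates to `k! / r ^ (k + 1)`. -/
lemma integral_pow_mul_exp_neg_mul_Ioi (k : ℕ) {r : ℝ} (hr : 0 < r) :
    ∫ x in Ioi (0 : ℝ), x ^ k * Real.exp (-(r * x)) = Nat.factorial k / r ^ (k + 1) := by
  have h := Real.integral_rpow_mul_exp_neg_mul_Ioi (a := (k : ℝ) + 1) (by positivity) hr
  simp only [add_sub_cancel_right, Real.rpow_natCast, Real.Gamma_nat_eq_factorial] at h
  rw [h, ← Nat.cast_add_one, Real.rpow_natCast, one_div, inv_pow, inv_mul_eq_div]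

/-- The joint density of the Poisson and Gamma steps started from an exponential law, integrated
over the initial state. -/
lemma integral_gamma_mul_poisson_mul_exponential {r ρ θ : ℝ} (hr : 0 < r) (hθ : ρ * r + θ = r)
    (y : ℝ) (k : ℕ) :
    ∫ x in Ioi (0 : ℝ),
        (r ^ (k + 1) * y ^ k * Real.exp (-r * y) / (Nat.factorial k)) *
          (Real.exp (-(ρ * r * x)) * (ρ * r * x) ^ k / (Nat.factorial k)) *
          (θ * Real.exp (-θ * x)) =
      θ * Real.exp (-r * y) * ((ρ * r * y) ^ k / (Nat.factorial k)) := by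
  have hk : (Nat.factorial k : ℝ) ≠ 0 := by positivity
  have hexp (x : ℝ) :
      Real.exp (-(r * x)) = Real.exp (-(ρ * r * x)) * Real.exp (-θ * x) := by
    rw [← Real.exp_add]
    congr 1
    linear_combination x * hθ
  calc
    _ = ∫ x in Ioi (0 : ℝ),
        (r ^ (k + 1) * y ^ k * Real.exp (-r * y) * (ρ * r) ^ k * θ / (Nat.factorial k) ^ 2) *
          (x ^ k * Real.exp (-(r * x))) := by
      congr 1 with x
      rw [hexp, mul_pow (ρ * r) x]
      field_simp
    _ = _ := by
      rw [integral_const_mul, integral_pow_mul_exp_neg_mul_Ioi k hr, mul_pow (ρ * r) y]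
      field_simp

/-- Invariance of the exponential distribution under the Poisson–Gamma
transition of the LAR process: with `r = λ²/(2(1−ρ))` and `θ = λ²/2`, if
`ψ ~ Exponential(θ)`, `κ|ψ ~ Poisson(ρ·r·ψ)` and
`ψ'|κ ~ Gamma(1+κ, rate r)`, then marginally `ψ' ~ Exponential(θ)`. -/
theorem exponential_invariant_poisson_gamma
    (lam ρ : ℝ) (hlam : 0 < lam) (hρ0 : 0 < ρ) (hρ1 : ρ < 1) :
    ∀ ψ' : ℝ, 0 < ψ' →
      (∑' k : ℕ,
        ∫ ψ in Ioi (0 : ℝ),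
          ((lam ^ 2 / (2 * (1 - ρ))) ^ (k + 1) * ψ' ^ k *
              Real.exp (-(lam ^ 2 / (2 * (1 - ρ))) * ψ') / (Nat.factorial k)) *
            (Real.exp (-(ρ * (lam ^ 2 / (2 * (1 - ρ))) * ψ)) *
              (ρ * (lam ^ 2 / (2 * (1 - ρ))) * ψ) ^ k / (Nat.factorial k)) *
            ((lam ^ 2 / 2) * Real.exp (-(lam ^ 2 / 2) * ψ))) =
        (lam ^ 2 / 2) * Real.exp (-(lam ^ 2 / 2) * ψ') := by
  intro y _
  have h1ρ : 0 < 1 - ρ := sub_pos.mpr hρ1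
  have hr : 0 < lam ^ 2 / (2 * (1 - ρ)) := by positivity
  have hθ : ρ * (lam ^ 2 / (2 * (1 - ρ))) + lam ^ 2 / 2 = lam ^ 2 / (2 * (1 - ρ)) := by
    field_simp
    ring
  generalize lam ^ 2 / (2 * (1 - ρ)) = r at hr hθ ⊢
  generalize lam ^ 2 / 2 = θ at hθ ⊢
  simp_rw [integral_gamma_mul_poisson_mul_exponential hr hθ]
  rw [tsum_mul_left, (NormedSpace.expSeries_div_hasSum_exp (ρ * r * y)).tsum_eq,
    ← Real.exp_eq_exp_ℝ, mul_assoc, ← Real.exp_add]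
  congr 2
  linear_combination y * hθ
end
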